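/- Let P be a projection on a Banach space X and T a bounded linear operator. Then T is uniformly P-ergodic if and only if T = P + Q, where Q is a bounded operator with PQ = QP = 0 and ‖Q^{n0}‖ < 1 for some n0 ∈ ℕ. -/

import Mathlib

open Filter Topology

noncomputable def dobrushin {X : Type*} [NormedAddCommGroup X] [NormedSpace ℝ X]
    (P A : X →L[ℝ] X) : ℝ :=
  sSup {r : ℝ | ∃ x : X, P x = 0 ∧ x ≠ 0 ∧ r = ‖A x‖ / ‖x‖}

theorem add_pow_succ_of_idempotent_of_mul_eq_zero {R : Type*} [Semiring R] {p q : R}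
    (hp : p * p = p) (hpq : p * q = 0) (hqp : q * p = 0) (n : ℕ) :
    (p + q) ^ (n + 1) = p + q ^ (n + 1) := by
  induction n with
  | zero => simp
  | succ n ih =>
    rw [pow_succ, ih, add_mul, mul_add, mul_add, hp, hpq, pow_succ q n, mul_assoc _ q p, hqp,
      mul_zero, add_zero, zero_add, ← pow_succ, ← pow_succ]

theorem tendsto_pow_atTop_nhds_zero_of_norm_pow_lt_one {R : Type*} [NormedRing R] {q : R}
    {m : ℕ} (h : ‖q ^ m‖ < 1) : Tendsto (fun n : ℕ => q ^ n) atTop (𝓝 0) := by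
  have key : Tendsto (fun k : ℕ => (q ^ m) ^ k) atTop (𝓝 0) :=
    tendsto_pow_atTop_nhds_zero_of_norm_lt_one h
  rcases Nat.eq_zero_or_pos m with rfl | hm
  · have one_eq_zero : (1 : R) = 0 := by
      simp only [pow_zero, one_pow] at key
      exact tendsto_nhds_unique tendsto_const_nhds key
    have : Subsingleton R := subsingleton_of_zero_eq_one one_eq_zero.symm
    exact tendsto_const_nhds.congr fun n => Subsingleton.elim 0 (q ^ n)
  · have hdiv := (key.comp (Nat.tendsto_div_const_atTop hm.ne')).norm
    have hbound := hdiv.mul_const (∑ r ∈ Finset.range m, ‖q ^ r‖)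
    rw [norm_zero, zero_mul] at hbound
    refine squeeze_zero_norm (fun n => ?_) hbound
    calc ‖q ^ n‖ = ‖(q ^ m) ^ (n / m) * q ^ (n % m)‖ := by
          rw [← pow_mul, ← pow_add, Nat.div_add_mod]
      _ ≤ ‖(q ^ m) ^ (n / m)‖ * ‖q ^ (n % m)‖ := norm_mul_le _ _
      _ ≤ ‖(q ^ m) ^ (n / m)‖ * ∑ r ∈ Finset.range m, ‖q ^ r‖ := by
          gcongr
          exact Finset.single_le_sum (f := fun r => ‖q ^ r‖) (fun _ _ => norm_nonneg _)
            (Finset.mem_range.2 (Nat.mod_lt n hm))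

theorem tendsto_pow_idempotent_iff {R : Type*} [NormedRing R] {p t : R} (hp : p * p = p) :
    Tendsto (fun n : ℕ => t ^ n) atTop (𝓝 p) ↔
      ∃ q : R, t = p + q ∧ p * q = 0 ∧ q * p = 0 ∧ ∃ m : ℕ, ‖q ^ m‖ < 1 := by
  constructor
  · intro h
    have hsucc : Tendsto (fun n : ℕ => t ^ (n + 1)) atTop (𝓝 p) :=
      (tendsto_add_atTop_iff_nat 1).2 h
    have hpt : p * t = p :=
      tendsto_nhds_unique ((h.mul_const t).congr fun n => (pow_succ t n).symm) hsucc
    have htp : t * p = p :=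
      tendsto_nhds_unique ((h.const_mul t).congr fun n => (pow_succ' t n).symm) hsucc
    have hpq : p * (t - p) = 0 := by rw [mul_sub, hpt, hp, sub_self]
    have hqp : (t - p) * p = 0 := by rw [sub_mul, htp, hp, sub_self]
    refine ⟨t - p, (add_sub_cancel p t).symm, hpq, hqp, ?_⟩
    have hlim : Tendsto (fun n : ℕ => ‖t ^ (n + 1) - p‖) atTop (𝓝 0) :=
      tendsto_iff_norm_sub_tendsto_zero.1 hsucc
    obtain ⟨n, hn⟩ := (hlim.eventually_lt_const one_pos).exists
    refine ⟨n + 1, ?_⟩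
    have hpow := add_pow_succ_of_idempotent_of_mul_eq_zero hp hpq hqp n
    rw [add_sub_cancel] at hpow
    rwa [hpow, add_sub_cancel_left] at hn
  · rintro ⟨q, rfl, hpq, hqp, m, hm⟩
    have hq := (tendsto_add_atTop_iff_nat 1).2 (tendsto_pow_atTop_nhds_zero_of_norm_pow_lt_one hm)
    refine (tendsto_add_atTop_iff_nat 1).1 ?_
    simpa [add_pow_succ_of_idempotent_of_mul_eq_zero hp hpq hqp] using hq.const_add p

theorem stmt12 {X : Type*} [NormedAddCommGroup X] [NormedSpace ℝ X] [CompleteSpace X]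
    (P T : X →L[ℝ] X) (hP : P * P = P) :
    Tendsto (fun n : ℕ => ‖T ^ n - P‖) atTop (𝓝 0) ↔
      ∃ Q : X →L[ℝ] X, T = P + Q ∧ P * Q = 0 ∧ Q * P = 0 ∧
        ∃ n0 : ℕ, ‖Q ^ n0‖ < 1 := by
  rw [← tendsto_iff_norm_sub_tendsto_zero]
  exact tendsto_pow_idempotent_iff hP
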